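/- Let ε = ±1 and let u : ℝ × ℝ → ℂ be a smooth solution of the derivative NLS i∂_t u + ∂_x²u - iε ∂_x(|u|²u) = 0 which is exponentially localized (there exist C, γ > 0 with |∂^α u(t,x)| ≤ C e^{-γ|x|} for all (t,x) and all space-time derivatives ∂^α of order at most 2) and time-periodic with some period T > 0. Define H[u] = -Im ∫_ℝ conj(u(0,x)) ∂_x u(0,x) dx + (ε/2) ∫_ℝ |u(0,x)|⁴ dx. If either (1) ε = -1 and H[u] ≤ 0, or (2) ε = 1 and H[u] ≥ 0, then u is identically zero. -/

import Mathlib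

open MeasureTheory Real Complex Function

/-- The conserved momentum-type functional of the derivative NLS (at `t = 0`):
`H[u] = -Im ∫ conj(u) ∂ₓu dx + (ε/2) ∫ |u|⁴ dx`. -/
noncomputable def Hdnls (ε : ℝ) (u : ℝ → ℝ → ℂ) : ℝ :=
  -(∫ x : ℝ, (starRingEnd ℂ) (u 0 x) * deriv (u 0) x).im + (ε / 2) * ∫ x : ℝ, ‖u 0 x‖ ^ 4

/-- Joint continuity together with exponential decay in the second variable, uniformly in the
first. -/
def ExpLocalized {E : Type*} [NormedAddCommGroup E] (f : ℝ → ℝ → E) : Prop :=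
  Continuous (uncurry f) ∧ ∃ γ > 0, ∃ K ≥ 0, ∀ t x, ‖f t x‖ ≤ K * Real.exp (-γ * |x|)

theorem integrable_exp_neg_mul_abs {γ : ℝ} (hγ : 0 < γ) :
    Integrable fun x : ℝ => Real.exp (-γ * |x|) := by
  rw [← integrableOn_univ, ← Set.Iic_union_Ioi (a := (0 : ℝ))]
  refine IntegrableOn.union ?_ ?_
  · refine (integrableOn_exp_mul_Iic hγ 0).congr_fun (fun x hx => ?_) measurableSet_Iic
    simp only [abs_of_nonpos (Set.mem_Iic.1 hx), neg_mul_neg]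
  · refine (integrableOn_exp_mul_Ioi (neg_neg_of_pos hγ) 0).congr_fun (fun x hx => ?_)
      measurableSet_Ioi
    simp only [abs_of_pos (Set.mem_Ioi.1 hx)]

namespace ExpLocalized

section NormedGroup

variable {E F : Type*} [NormedAddCommGroup E] [NormedAddCommGroup F]

theorem of_norm_le {f : ℝ → ℝ → E} {g : ℝ → ℝ → F} (hf : ExpLocalized f)
    (hg : Continuous (uncurry g)) (h : ∀ t x, ‖g t x‖ ≤ ‖f t x‖) : ExpLocalized g := by
  obtain ⟨-, γ, hγ, K, hK, hb⟩ := hf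
  exact ⟨hg, γ, hγ, K, hK, fun t x => (h t x).trans (hb t x)⟩

theorem add {f g : ℝ → ℝ → E} (hf : ExpLocalized f) (hg : ExpLocalized g) :
    ExpLocalized fun t x => f t x + g t x := by
  obtain ⟨hf, γ, hγ, K, hK, hb⟩ := hf
  obtain ⟨hg, δ, hδ, L, hL, hc⟩ := hg
  refine ⟨hf.add hg, min γ δ, lt_min hγ hδ, K + L, by positivity, fun t x => ?_⟩
  have h1 : Real.exp (-γ * |x|) ≤ Real.exp (-min γ δ * |x|) := by gcongr; exact min_le_left _ _
  have h2 : Real.exp (-δ * |x|) ≤ Real.exp (-min γ δ * |x|) := by gcongr; exact min_le_right _ _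
  calc ‖f t x + g t x‖ ≤ K * Real.exp (-γ * |x|) + L * Real.exp (-δ * |x|) :=
        (norm_add_le _ _).trans (add_le_add (hb t x) (hc t x))
    _ ≤ K * Real.exp (-min γ δ * |x|) + L * Real.exp (-min γ δ * |x|) := by gcongr
    _ = _ := by ring

theorem neg {f : ℝ → ℝ → E} (hf : ExpLocalized f) : ExpLocalized fun t x => -f t x :=
  hf.of_norm_le hf.1.neg fun t x => (norm_neg (f t x)).le

theorem sub {f g : ℝ → ℝ → E} (hf : ExpLocalized f) (hg : ExpLocalized g) :
    ExpLocalized fun t x => f t x - g t x := by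
  simpa only [sub_eq_add_neg] using hf.add hg.neg

theorem continuous_right {f : ℝ → ℝ → E} (hf : ExpLocalized f) (t : ℝ) : Continuous (f t) :=
  hf.1.comp (Continuous.prodMk_right t)

theorem integrable {f : ℝ → ℝ → E} (hf : ExpLocalized f) (t : ℝ) : Integrable (f t) := by
  have hc := hf.continuous_right t
  obtain ⟨-, γ, hγ, K, -, hb⟩ := hf
  exact ((integrable_exp_neg_mul_abs hγ).const_mul K).mono' hc.aestronglyMeasurable
    (.of_forall (hb t))

end NormedGroup

theorem mul {f g : ℝ → ℝ → ℝ} (hf : ExpLocalized f) (hg : ExpLocalized g) :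
    ExpLocalized fun t x => f t x * g t x := by
  obtain ⟨hf, γ, hγ, K, hK, hb⟩ := hf
  obtain ⟨hg, δ, hδ, L, hL, hc⟩ := hg
  refine ⟨hf.mul hg, γ + δ, add_pos hγ hδ, K * L, by positivity, fun t x => ?_⟩
  calc ‖f t x * g t x‖ ≤ (K * Real.exp (-γ * |x|)) * (L * Real.exp (-δ * |x|)) := by
        rw [norm_mul]
        exact mul_le_mul (hb t x) (hc t x) (norm_nonneg _) (by positivity)
    _ = _ := by
        rw [show -(γ + δ) * |x| = -γ * |x| + -δ * |x| by ring, Real.exp_add]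
        ring

theorem const_mul (c : ℝ) {f : ℝ → ℝ → ℝ} (hf : ExpLocalized f) :
    ExpLocalized fun t x => c * f t x := by
  obtain ⟨hf, γ, hγ, K, hK, hb⟩ := hf
  refine ⟨continuous_const.mul hf, γ, hγ, |c| * K, by positivity, fun t x => ?_⟩
  rw [norm_mul, Real.norm_eq_abs c, mul_assoc]
  exact mul_le_mul_of_nonneg_left (hb t x) (abs_nonneg c)

theorem id_mul {f : ℝ → ℝ → ℝ} (hf : ExpLocalized f) :
    ExpLocalized fun t x => x * f t x := by
  obtain ⟨hf, γ, hγ, K, hK, hb⟩ := hf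
  refine ⟨continuous_snd.mul hf, γ / 2, half_pos hγ, 2 / γ * K, by positivity, fun t x => ?_⟩
  have h1 : |x| ≤ 2 / γ * Real.exp (γ / 2 * |x|) := by
    have := Real.add_one_le_exp (γ / 2 * |x|)
    calc |x| = 2 / γ * (γ / 2 * |x|) := by field_simp
      _ ≤ _ := by gcongr; linarith
  calc ‖x * f t x‖ = |x| * ‖f t x‖ := norm_mul _ _
    _ ≤ (2 / γ * Real.exp (γ / 2 * |x|)) * (K * Real.exp (-γ * |x|)) :=
        mul_le_mul h1 (hb t x) (norm_nonneg _) (by positivity)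
    _ = 2 / γ * K * (Real.exp (γ / 2 * |x|) * Real.exp (-γ * |x|)) := by ring
    _ = _ := by rw [← Real.exp_add]; ring_nf

theorem re {f : ℝ → ℝ → ℂ} (hf : ExpLocalized f) : ExpLocalized fun t x => (f t x).re :=
  hf.of_norm_le (Complex.continuous_re.comp hf.1) fun t x => Complex.abs_re_le_norm (f t x)

theorem im {f : ℝ → ℝ → ℂ} (hf : ExpLocalized f) : ExpLocalized fun t x => (f t x).im :=
  hf.of_norm_le (Complex.continuous_im.comp hf.1) fun t x => Complex.abs_im_le_norm (f t x)

/-- Differentiation under the integral sign for a balance law `∂ₜ f = ∂ₓ F - q`. -/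
theorem hasDerivAt_integral_of_flux {f p F q : ℝ → ℝ → ℝ} (hf : ExpLocalized f)
    (hp : ExpLocalized p) (hF : ExpLocalized F) (hq : ExpLocalized q)
    (hft : ∀ t x, HasDerivAt (fun s => f s x) (p t x) t)
    (hFx : ∀ t x, HasDerivAt (F t) (p t x + q t x) x) (t : ℝ) :
    HasDerivAt (fun s => ∫ x, f s x) (-∫ x, q t x) t := by
  have hzero : ∫ x, (p t x + q t x) = 0 :=
    integral_eq_zero_of_hasDerivAt_of_integrable (hFx t) ((hp.add hq).integrable t)
      (hF.integrable t)
  rw [integral_add (hp.integrable t) (hq.integrable t)] at hzero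
  obtain ⟨-, γ, hγ, K, -, hb⟩ := id hp
  have key := (hasDerivAt_integral_of_dominated_loc_of_deriv_le (μ := volume) (F := f) (F' := p)
    (x₀ := t) (bound := fun x => K * Real.exp (-γ * |x|)) Filter.univ_mem
    (.of_forall fun s => (hf.continuous_right s).aestronglyMeasurable) (hf.integrable t)
    (hp.continuous_right t).aestronglyMeasurable (.of_forall fun x s _ => hb s x)
    ((integrable_exp_neg_mul_abs hγ).const_mul K) (.of_forall fun x s _ => hft s x)).2
  rwa [show -∫ x, q t x = ∫ x, p t x by linarith]

end ExpLocalized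

/-- A monotone periodic function is constant. -/
theorem Monotone.eq_of_periodic {W : ℝ → ℝ} (hW : Monotone W) {T : ℝ} (hT : 0 < T)
    (hper : Periodic W T) (s t : ℝ) : W s = W t := by
  have key : ∀ s t, W s ≤ W t := fun s t => by
    obtain ⟨n, hn⟩ := exists_nat_ge ((s - t) / T)
    rw [div_le_iff₀ hT] at hn
    exact (hW (by linarith : s ≤ t + n * T)).trans_eq (hper.nat_mul n t)
  exact le_antisymm (key s t) (key t s)

/-- The virial argument for the derivative NLS, written in terms of the real part `a` and the
imaginary part `b` of the solution. -/
theorem eq_zero_of_dnls_real_system {ε T : ℝ} (hε : ε * ε = 1) (hT : 0 < T)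
    {a at' ax axx axt b bt bx bxx bxt : ℝ → ℝ → ℝ}
    (ha : ExpLocalized a) (hat : ExpLocalized at') (hax : ExpLocalized ax)
    (haxt : ExpLocalized axt)
    (hb : ExpLocalized b) (hbt : ExpLocalized bt) (hbx : ExpLocalized bx)
    (hbxt : ExpLocalized bxt)
    (da_t : ∀ t x, HasDerivAt (fun s => a s x) (at' t x) t)
    (da_x : ∀ t x, HasDerivAt (a t) (ax t x) x)
    (da_xx : ∀ t x, HasDerivAt (ax t) (axx t x) x)
    (da_xt : ∀ t x, HasDerivAt (fun s => ax s x) (axt t x) t)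
    (da_tx : ∀ t x, HasDerivAt (at' t) (axt t x) x)
    (db_t : ∀ t x, HasDerivAt (fun s => b s x) (bt t x) t)
    (db_x : ∀ t x, HasDerivAt (b t) (bx t x) x)
    (db_xx : ∀ t x, HasDerivAt (bx t) (bxx t x) x)
    (db_xt : ∀ t x, HasDerivAt (fun s => bx s x) (bxt t x) t)
    (db_tx : ∀ t x, HasDerivAt (bt t) (bxt t x) x)
    (eqa : ∀ t x, at' t x = -bxx t x + ε * (2 * (a t x * ax t x + b t x * bx t x) * a t x
      + (a t x * a t x + b t x * b t x) * ax t x))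
    (eqb : ∀ t x, bt t x = axx t x + ε * (2 * (a t x * ax t x + b t x * bx t x) * b t x
      + (a t x * a t x + b t x * b t x) * bx t x))
    (hpa : ∀ t x, a (t + T) x = a t x) (hpb : ∀ t x, b (t + T) x = b t x)
    (hH : 0 ≤ ε * ∫ x, (-(a 0 x * bx 0 x - b 0 x * ax 0 x)
      + ε / 2 * ((a 0 x * a 0 x + b 0 x * b 0 x) * (a 0 x * a 0 x + b 0 x * b 0 x))))
    (t x : ℝ) : a t x = 0 ∧ b t x = 0 := by
  set ρ : ℝ → ℝ → ℝ := fun t x => a t x * a t x + b t x * b t x with hρ_def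
  set m : ℝ → ℝ → ℝ := fun t x => a t x * bx t x - b t x * ax t x with hm_def
  set h : ℝ → ℝ → ℝ := fun t x => -m t x + ε / 2 * (ρ t x * ρ t x) with hh_def
  have hρ : ExpLocalized ρ := (ha.mul ha).add (hb.mul hb)
  have hm : ExpLocalized m := (ha.mul hbx).sub (hb.mul hax)
  have hh : ExpLocalized h := hm.neg.add ((hρ.mul hρ).const_mul _)
  have dρ_t : ∀ t x, HasDerivAt (fun s => ρ s x) (2 * (a t x * at' t x + b t x * bt t x)) t :=
    fun t x => (((da_t t x).mul (da_t t x)).add ((db_t t x).mul (db_t t x))).congr_deriv (by ring)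
  have dρ_x : ∀ t x, HasDerivAt (ρ t) (2 * (a t x * ax t x + b t x * bx t x)) x :=
    fun t x => (((da_x t x).mul (da_x t x)).add ((db_x t x).mul (db_x t x))).congr_deriv (by ring)
  have dm_x : ∀ t x, HasDerivAt (m t) (a t x * bxx t x - b t x * axx t x) x :=
    fun t x => (((da_x t x).mul (db_xx t x)).sub ((db_x t x).mul (da_xx t x))).congr_deriv
      (by ring)
  have hρt : ExpLocalized fun t x => 2 * (a t x * at' t x + b t x * bt t x) :=
    ((ha.mul hat).add (hb.mul hbt)).const_mul 2
  have hmt : ExpLocalized fun t x =>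
      at' t x * bx t x + a t x * bxt t x - (bt t x * ax t x + b t x * axt t x) :=
    ((hat.mul hbx).add (ha.mul hbxt)).sub ((hbt.mul hax).add (hb.mul haxt))
  have hconst : ∀ t, ∫ x, h t x = ∫ x, h 0 x := fun t => by
    have hder : ∀ t, HasDerivAt (fun s => ∫ x, h s x) 0 t := fun t => by
      have hF : ExpLocalized fun t x => -(a t x * bt t x - b t x * at' t x)
          + (ax t x * ax t x + bx t x * bx t x) - 2 * ε * (ρ t x * m t x)
          + ρ t x * (ρ t x * ρ t x) :=
        (((((ha.mul hbt).sub (hb.mul hat)).neg).add ((hax.mul hax).add (hbx.mul hbx))).sub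
          ((hρ.mul hm).const_mul _)).add (hρ.mul (hρ.mul hρ))
      refine (hh.hasDerivAt_integral_of_flux
        (hmt.neg.add ((hρ.mul hρt).const_mul ε)) hF (q := fun t x => 0 * a t x) (ha.const_mul 0)
        (fun t x => ?_) (fun t x => ?_) t).congr_deriv (by simp)
      · exact (((((da_t t x).mul (db_xt t x)).sub ((db_t t x).mul (da_xt t x))).neg).add
          (((dρ_t t x).mul (dρ_t t x)).const_mul (ε / 2))).congr_deriv (by ring)
      · refine ((((((da_x t x).mul (db_tx t x)).sub ((db_x t x).mul (da_tx t x))).neg.add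
          (((da_xx t x).mul (da_xx t x)).add ((db_xx t x).mul (db_xx t x)))).sub
          (((dρ_x t x).mul (dm_x t x)).const_mul (2 * ε))).add
          ((dρ_x t x).mul ((dρ_x t x).mul (dρ_x t x)))).congr_deriv ?_
        simp only [Pi.mul_apply, hρ_def, hm_def]
        linear_combination (2 * bx t x - 2 * ε * (a t x * a t x + b t x * b t x) * a t x) * eqa t x
          - (2 * ax t x + 2 * ε * (a t x * a t x + b t x * b t x) * b t x) * eqb t x
          - 6 * (a t x * a t x + b t x * b t x) ^ 2 * (a t x * ax t x + b t x * bx t x) * hε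
    exact is_const_of_deriv_eq_zero (fun s => (hder s).differentiableAt)
      (fun s => (hder s).deriv) t 0
  have dV : ∀ t, HasDerivAt (fun s => ∫ x, x * ρ s x)
      (-∫ x, (2 * h t x + ε / 2 * (ρ t x * ρ t x))) t := by
    have hQ : ExpLocalized fun t x => 2 * h t x + ε / 2 * (ρ t x * ρ t x) :=
      (hh.const_mul 2).add ((hρ.mul hρ).const_mul _)
    refine hρ.id_mul.hasDerivAt_integral_of_flux hρt.id_mul hQ.id_mul hQ
      (fun t x => (dρ_t t x).const_mul x) (fun t x => ?_)
    refine ((hasDerivAt_id x).mul ((((dm_x t x).neg.add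
      (((dρ_x t x).mul (dρ_x t x)).const_mul (ε / 2))).const_mul 2).add
      (((dρ_x t x).mul (dρ_x t x)).const_mul (ε / 2)))).congr_deriv ?_
    simp only [id, Pi.add_apply, Pi.mul_apply, Pi.neg_apply, hh_def, hρ_def, hm_def]
    linear_combination (-2 * x * a t x) * eqa t x - 2 * x * b t x * eqb t x
  set W : ℝ → ℝ := fun s => -ε * ∫ x, x * ρ s x with hW_def
  have dW : ∀ t, HasDerivAt W
      (2 * (ε * ∫ x, h 0 x) + 1 / 2 * ∫ x, ρ t x * ρ t x) t := fun t => by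
    refine ((dV t).const_mul (-ε)).congr_deriv ?_
    rw [integral_add ((hh.integrable t).const_mul 2)
      (((hρ.mul hρ).integrable t).const_mul (ε / 2)), integral_const_mul, integral_const_mul,
      hconst t]
    linear_combination (1 / 2 * ∫ x, ρ t x * ρ t x) * hε
  have hI : ∀ t, 0 ≤ ∫ x, ρ t x * ρ t x := fun t =>
    integral_nonneg fun x => mul_self_nonneg (ρ t x)
  have hmono : Monotone W := monotone_of_deriv_nonneg (fun t => (dW t).differentiableAt)
    fun t => by
      rw [(dW t).deriv]
      linarith [hI t]
  have hWper : Periodic W T := fun t => by simp only [hW_def, hρ_def, hpa, hpb]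
  have hWc : W = fun _ => W 0 := funext fun t => hmono.eq_of_periodic hT hWper t 0
  have hzero : ∫ x, ρ t x * ρ t x = 0 := by
    have hc : HasDerivAt W 0 t := by
      rw [hWc]
      exact hasDerivAt_const t (W 0)
    have h0 := (dW t).unique hc
    linarith [hI t]
  have hfun : (fun x => ρ t x * ρ t x) = 0 :=
    (((hρ.mul hρ).continuous_right t).ae_eq_iff_eq volume continuous_zero).1
      ((integral_eq_zero_iff_of_nonneg (fun x => mul_self_nonneg (ρ t x))
        ((hρ.mul hρ).integrable t)).1 hzero)
  have hρ0 : a t x * a t x + b t x * b t x = 0 := mul_self_eq_zero.1 (congrFun hfun x)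
  constructor <;> nlinarith [mul_self_nonneg (a t x), mul_self_nonneg (b t x)]

/-- The partial derivatives of order at most two of a smooth function whose derivatives of order
at most two are exponentially localized. -/
theorem exists_partials_expLocalized {U : ℝ × ℝ → ℂ} (hsmooth : ContDiff ℝ (⊤ : ℕ∞) U)
    (hloc : ∃ C > 0, ∃ γ > 0, ∀ k : ℕ, k ≤ 2 → ∀ (t x : ℝ),
      ‖iteratedFDeriv ℝ k U (t, x)‖ ≤ C * Real.exp (-γ * |x|)) :
    ExpLocalized (curry U) ∧ ∃ ut ux uxx uxt : ℝ → ℝ → ℂ,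
      ExpLocalized ut ∧ ExpLocalized ux ∧ ExpLocalized uxt ∧
      (∀ t x, HasDerivAt (fun s => U (s, x)) (ut t x) t) ∧
      (∀ t x, HasDerivAt (fun y => U (t, y)) (ux t x) x) ∧
      (∀ t x, HasDerivAt (ux t) (uxx t x) x) ∧
      (∀ t x, HasDerivAt (fun s => ux s x) (uxt t x) t) ∧
      (∀ t x, HasDerivAt (ut t) (uxt t x) x) := by
  obtain ⟨C, hC, γ, hγ, hb⟩ := hloc
  have hU3 : ContDiff ℝ 3 U := contDiff_infty.1 hsmooth 3
  have hD1 : ContDiff ℝ 2 (fderiv ℝ U) := hU3.fderiv_right (by norm_num)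
  have hD2 : ContDiff ℝ 1 (fderiv ℝ (fderiv ℝ U)) := hD1.fderiv_right (by norm_num)
  have dU : ∀ z, HasFDerivAt U (fderiv ℝ U z) z := fun z =>
    (hU3.differentiable (by norm_num) z).hasFDerivAt
  have dDU : ∀ v z, HasFDerivAt (fun w => fderiv ℝ U w v)
      ((fderiv ℝ (fderiv ℝ U) z).flip v) z := fun v z =>
    ((ContinuousLinearMap.apply ℝ ℂ v).hasFDerivAt.comp z
      (hD1.differentiable (by norm_num) z).hasFDerivAt).congr_fderiv (by ext <;> rfl)
  have line_t : ∀ t x : ℝ, HasDerivAt (fun s : ℝ => (s, x)) ((1 : ℝ), (0 : ℝ)) t := fun t x =>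
    (hasDerivAt_id t).prodMk (hasDerivAt_const t x)
  have line_x : ∀ t x : ℝ, HasDerivAt (fun y : ℝ => (t, y)) ((0 : ℝ), (1 : ℝ)) x := fun t x =>
    (hasDerivAt_const x t).prodMk (hasDerivAt_id x)
  have n_t : ‖((1 : ℝ), (0 : ℝ))‖ = 1 := by simp [Prod.norm_def]
  have n_x : ‖((0 : ℝ), (1 : ℝ))‖ = 1 := by simp [Prod.norm_def]
  have b1 : ∀ v : ℝ × ℝ, ‖v‖ = 1 → ExpLocalized fun t x => fderiv ℝ U (t, x) v := by
    refine fun v hv => ⟨hD1.continuous.clm_apply continuous_const, γ, hγ, C, hC.le, fun t x => ?_⟩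
    refine le_trans ?_ (hb 1 (by norm_num) t x)
    rw [norm_iteratedFDeriv_one]
    exact ((fderiv ℝ U (t, x)).le_opNorm v).trans_eq (by rw [hv, mul_one])
  have b2 : ∀ v w : ℝ × ℝ, ‖v‖ = 1 → ‖w‖ = 1 →
      ExpLocalized fun t x => fderiv ℝ (fderiv ℝ U) (t, x) v w := by
    refine fun v w hv hw => ⟨(hD2.continuous.clm_apply continuous_const).clm_apply
      continuous_const, γ, hγ, C, hC.le, fun t x => ?_⟩
    refine le_trans ?_ (hb 2 le_rfl t x)
    rw [← norm_iteratedFDeriv_fderiv, norm_iteratedFDeriv_one]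
    exact ((fderiv ℝ (fderiv ℝ U) (t, x)).le_opNorm₂ v w).trans_eq
      (by rw [hv, hw, mul_one, mul_one])
  refine ⟨⟨hU3.continuous, γ, hγ, C, hC.le, fun t x => ?_⟩,
    fun t x => fderiv ℝ U (t, x) (1, 0), fun t x => fderiv ℝ U (t, x) (0, 1),
    fun t x => fderiv ℝ (fderiv ℝ U) (t, x) (0, 1) (0, 1),
    fun t x => fderiv ℝ (fderiv ℝ U) (t, x) (1, 0) (0, 1),
    b1 _ n_t, b1 _ n_x, b2 _ _ n_t n_x, fun t x => (dU (t, x)).comp_hasDerivAt t (line_t t x),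
    fun t x => (dU (t, x)).comp_hasDerivAt x (line_x t x),
    fun t x => (dDU (0, 1) (t, x)).comp_hasDerivAt x (line_x t x),
    fun t x => ((dDU (0, 1) (t, x)).comp_hasDerivAt t (line_t t x) :), fun t x => ?_⟩
  · exact (norm_iteratedFDeriv_zero (𝕜 := ℝ) (f := U)).symm.trans_le (hb 0 (by norm_num) t x)
  · have hsymm : IsSymmSndFDerivAt ℝ U (t, x) := hU3.contDiffAt.isSymmSndFDerivAt (by norm_num)
    exact ((dDU (1, 0) (t, x)).comp_hasDerivAt x (line_x t x)).congr_deriv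
      (hsymm (0, 1) (1, 0))

/-- **Nonexistence of breathers for the derivative NLS.**
A smooth, exponentially localized, time-periodic solution of
`i ∂ₜ u + ∂ₓ²u - iε ∂ₓ(|u|²u) = 0` in the regimes (1) `ε = -1`, `H[u] ≤ 0` or
(2) `ε = 1`, `H[u] ≥ 0` is identically zero. -/
theorem no_derivative_NLS_breather (ε : ℝ) (hε : ε = 1 ∨ ε = -1)
    (u : ℝ → ℝ → ℂ)
    (hsmooth : ContDiff ℝ (⊤ : ℕ∞) (Function.uncurry u))
    (heq : ∀ (t x : ℝ),
      Complex.I * deriv (fun s => u s x) t + deriv (fun y => deriv (u t) y) x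
        - Complex.I * (ε : ℂ) * deriv (fun y => ((‖u t y‖ ^ 2 : ℝ) : ℂ) * u t y) x = 0)
    (hloc : ∃ C > 0, ∃ γ > 0, ∀ k : ℕ, k ≤ 2 → ∀ (t x : ℝ),
      ‖iteratedFDeriv ℝ k (Function.uncurry u) (t, x)‖ ≤ C * Real.exp (-γ * |x|))
    (hper : ∃ T > 0, ∀ (t x : ℝ), u (t + T) x = u t x)
    (hreg : (ε = -1 ∧ Hdnls ε u ≤ 0) ∨ (ε = 1 ∧ 0 ≤ Hdnls ε u)) :
    ∀ t x, u t x = 0 := by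

  obtain ⟨hu : ExpLocalized u, ut, ux, uxx, uxt, hut, hux, huxt, (d_t : ∀ t x, HasDerivAt (fun s => u s x) (ut t x) t),
      (d_x : ∀ t x, HasDerivAt (u t) (ux t x) x), d_xx, d_xt, d_tx⟩ :=
    exists_partials_expLocalized hsmooth hloc
  obtain ⟨T, hT, hper⟩ := hper
  have hre : ∀ {f : ℝ → ℂ} {f' : ℂ} {r : ℝ}, HasDerivAt f f' r →
      HasDerivAt (fun s => (f s).re) f'.re r := fun h =>
    Complex.reCLM.hasFDerivAt.comp_hasDerivAt _ h
  have him : ∀ {f : ℝ → ℂ} {f' : ℂ} {r : ℝ}, HasDerivAt f f' r →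
      HasDerivAt (fun s => (f s).im) f'.im r := fun h =>
    Complex.imCLM.hasFDerivAt.comp_hasDerivAt _ h
  have hsq : ∀ z : ℂ, ‖z‖ ^ 2 = z.re * z.re + z.im * z.im := fun z => by
    rw [Complex.sq_norm, Complex.normSq_apply]
  have deriv_ux : ∀ t, deriv (u t) = ux t := fun t => funext fun x => (d_x t x).deriv
  have heq' : ∀ t x, Complex.I * ut t x + uxx t x - Complex.I * (ε : ℂ) *
      (((2 * ((u t x).re * (ux t x).re + (u t x).im * (ux t x).im) : ℝ) : ℂ) * u t x
        + (((u t x).re * (u t x).re + (u t x).im * (u t x).im : ℝ) : ℂ) * ux t x) = 0 := by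
    intro t x
    have h := heq t x
    simp only [hsq, deriv_ux] at h
    have hρ : HasDerivAt (fun y => (u t y).re * (u t y).re + (u t y).im * (u t y).im)
        (2 * ((u t x).re * (ux t x).re + (u t x).im * (ux t x).im)) x :=
      (((hre (d_x t x)).mul (hre (d_x t x))).add
        ((him (d_x t x)).mul (him (d_x t x)))).congr_deriv (by ring)
    have hN : HasDerivAt (fun y => (((u t y).re * (u t y).re + (u t y).im * (u t y).im : ℝ) : ℂ)
        * u t y) _ x := hρ.ofReal_comp.mul (d_x t x)
    rwa [(d_t t x).deriv, (d_xx t x).deriv, hN.deriv] at h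
  have hHeq : Hdnls ε u = ∫ x, (-((u 0 x).re * (ux 0 x).im - (u 0 x).im * (ux 0 x).re)
      + ε / 2 * (((u 0 x).re * (u 0 x).re + (u 0 x).im * (u 0 x).im)
        * ((u 0 x).re * (u 0 x).re + (u 0 x).im * (u 0 x).im))) := by
    have hρ := (hu.re.mul hu.re).add (hu.im.mul hu.im)
    have hm := (hu.re.mul hux.im).sub (hu.im.mul hux.re)
    have hc : Integrable fun x => (starRingEnd ℂ) (u 0 x) * ux 0 x := by
      refine (((hu.re.mul hux.re).add (hu.im.mul hux.im)).integrable 0).ofReal.add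
        ((hm.integrable 0).ofReal.mul_const Complex.I) |>.congr (.of_forall fun x => ?_)
      apply Complex.ext <;> simp
      ring
    rw [integral_add (hm.neg.integrable 0) (((hρ.mul hρ).integrable 0).const_mul _),
      integral_neg, integral_const_mul, Hdnls, deriv_ux]
    congr 2
    · rw [← RCLike.im_eq_complex_im, ← integral_im hc]
      congr 1
      ext x
      simp
      ring
    · congr 1
      ext x
      rw [← hsq]
      ring
  intro t x
  have hεε : ε * ε = 1 := by rcases hε with rfl | rfl <;> norm_num
  have hH : 0 ≤ ε * Hdnls ε u := by
    rcases hreg with ⟨h, h'⟩ | ⟨h, h'⟩ <;> rw [h] at h' ⊢ <;> linarith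
  rw [hHeq] at hH
  obtain ⟨h1, h2⟩ := eq_zero_of_dnls_real_system hεε hT hu.re hut.re hux.re huxt.re
    hu.im hut.im hux.im huxt.im
    (fun t x => hre (d_t t x)) (fun t x => hre (d_x t x)) (fun t x => hre (d_xx t x))
    (fun t x => hre (d_xt t x)) (fun t x => hre (d_tx t x))
    (fun t x => him (d_t t x)) (fun t x => him (d_x t x)) (fun t x => him (d_xx t x))
    (fun t x => him (d_xt t x)) (fun t x => him (d_tx t x))
    (fun t x => by
      have h := congrArg Complex.im (heq' t x)
      simp at h
      linarith)
    (fun t x => by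
      have h := congrArg Complex.re (heq' t x)
      simp at h
      linarith)
    (fun t x => by rw [hper]) (fun t x => by rw [hper]) hH t x
  exact Complex.ext h1 h2
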